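/- Let t_1, t_2 ∈ ℝ and set t_3 = −t_1−t_2, β_1 = 2t_1+t_2, β_2 = t_2−t_1, β_3 = −t_1−2t_2. Then for all u_1, u_2 ∈ ℝ: 3(|t_1|+|t_2|+|t_3|) + |u_1+u_2| ≤ Σ_{j=1}^3 |u_1 − β_j| + Σ_{j=1}^3 |u_2 + β_j|. -/

import Mathlib

/-- For sorted `a ≤ b ≤ c` the outer terms are at least `c - a` for each of `u`, `-v`, and the middle
terms are at least `|u + v|`. -/
lemma two_mul_spread_add_abs_add_le {a b c : ℝ} (hab : a ≤ b) (hbc : b ≤ c) (u v : ℝ) :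
    |a - b| + |b - c| + |c - a| + |u + v| ≤
      (|u - a| + |u - b| + |u - c|) + (|v + a| + |v + b| + |v + c|) := by
  rw [abs_of_nonpos (sub_nonpos.2 hab), abs_of_nonpos (sub_nonpos.2 hbc),
    abs_of_nonneg (sub_nonneg.2 (hab.trans hbc))]
  have hmid : |u + v| ≤ |u - b| + |v + b| := by
    simpa using abs_add_le (u - b) (v + b)
  linarith [le_abs_self (u - a), neg_le_abs (u - c), neg_le_abs (v + a), le_abs_self (v + c)]

lemma sum_abs_sub_add_abs_add_le (a b c u v : ℝ) :
    |a - b| + |b - c| + |c - a| + |u + v| ≤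
      (|u - a| + |u - b| + |u - c|) + (|v + a| + |v + b| + |v + c|) := by
  have hab := abs_sub_comm a b
  have hbc := abs_sub_comm b c
  have hca := abs_sub_comm c a
  rcases le_total a b with h₁ | h₁ <;> rcases le_total b c with h₂ | h₂ <;>
    rcases le_total a c with h₃ | h₃
  · linarith [two_mul_spread_add_abs_add_le h₁ h₂ u v]
  · linarith [two_mul_spread_add_abs_add_le h₁ h₂ u v]
  · linarith [two_mul_spread_add_abs_add_le h₃ h₂ u v]
  · linarith [two_mul_spread_add_abs_add_le h₃ h₁ u v]
  · linarith [two_mul_spread_add_abs_add_le h₁ h₃ u v]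
  · linarith [two_mul_spread_add_abs_add_le h₂ h₃ u v]
  · linarith [two_mul_spread_add_abs_add_le h₂ h₁ u v]
  · linarith [two_mul_spread_add_abs_add_le h₂ h₁ u v]

/-- With `t₃ = −t₁−t₂`, `β₁ = 2t₁+t₂`, `β₂ = t₂−t₁`, `β₃ = −t₁−2t₂`, one has
`3(|t₁|+|t₂|+|t₃|) + |u₁+u₂| ≤ Σ_j |u₁ − β_j| + Σ_j |u₂ + β_j|`. -/
theorem exponential_factor_nonpositive (t₁ t₂ u₁ u₂ : ℝ) :
    3 * (|t₁| + |t₂| + |-t₁ - t₂|) + |u₁ + u₂| ≤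
      (|u₁ - (2 * t₁ + t₂)| + |u₁ - (t₂ - t₁)| + |u₁ - (-t₁ - 2 * t₂)|) +
      (|u₂ + (2 * t₁ + t₂)| + |u₂ + (t₂ - t₁)| + |u₂ + (-t₁ - 2 * t₂)|) := by
  have h := sum_abs_sub_add_abs_add_le (2 * t₁ + t₂) (t₂ - t₁) (-t₁ - 2 * t₂) u₁ u₂
  have h₁ : |2 * t₁ + t₂ - (t₂ - t₁)| = 3 * |t₁| := by
    rw [show 2 * t₁ + t₂ - (t₂ - t₁) = 3 * t₁ by ring, abs_mul, abs_of_pos three_pos]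
  have h₂ : |t₂ - t₁ - (-t₁ - 2 * t₂)| = 3 * |t₂| := by
    rw [show t₂ - t₁ - (-t₁ - 2 * t₂) = 3 * t₂ by ring, abs_mul, abs_of_pos three_pos]
  have h₃ : |-t₁ - 2 * t₂ - (2 * t₁ + t₂)| = 3 * |-t₁ - t₂| := by
    rw [show -t₁ - 2 * t₂ - (2 * t₁ + t₂) = 3 * (-t₁ - t₂) by ring, abs_mul, abs_of_pos three_pos]
  linarith
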